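/- arXiv:2508.10530 — 7 statements merged into one kernel-verified Lean document; each statement's English description precedes it below -/
import Mathlib

section
/- (Existence part of the bijection between reward functions and policies.) Let Y be a nonempty finite type, β > 0, and let π_θ and π_ref be positive probability distributions on Y. Define the reward r : Y → ℝ by r(y) = β·(log π_θ(y) − log π_ref(y)). Then π_θ is the unique maximizer of the KL-regularized alignment objective F over positive probability distributions on Y: F(π) ≤ F(π_θ) for every positive probability distribution π, with equality if and only if π = π_θ. -/
theorem mul_log_sub_log_lt_sub {p q : ℝ} (hp : 0 < p) (hq : 0 < q) (h : p ≠ q) :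
    p * (Real.log q - Real.log p) < q - p := by
  have hlog := Real.log_lt_sub_one_of_pos (div_pos hq hp)
    (fun hdiv => h ((div_eq_one_iff_eq hp.ne').mp hdiv).symm)
  rw [Real.log_div hq.ne' hp.ne'] at hlog
  calc p * (Real.log q - Real.log p) < p * (q / p - 1) := mul_lt_mul_of_pos_left hlog hp
    _ = q - p := by field_simp

theorem mul_log_sub_log_le_sub {p q : ℝ} (hp : 0 < p) (hq : 0 < q) :
    p * (Real.log q - Real.log p) ≤ q - p := by
  rcases eq_or_ne p q with rfl | h
  · simp
  · exact (mul_log_sub_log_lt_sub hp hq h).le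

section Gibbs

variable {Y : Type*} [Fintype Y] {p q : Y → ℝ}

/-- Gibbs' inequality. -/
theorem sum_mul_log_sub_log_nonpos (hp : ∀ y, 0 < p y) (hq : ∀ y, 0 < q y)
    (hsum : ∑ y, p y = ∑ y, q y) :
    ∑ y, p y * (Real.log (q y) - Real.log (p y)) ≤ 0 :=
  calc ∑ y, p y * (Real.log (q y) - Real.log (p y)) ≤ ∑ y, (q y - p y) :=
        Finset.sum_le_sum fun y _ => mul_log_sub_log_le_sub (hp y) (hq y)
    _ = 0 := by rw [Finset.sum_sub_distrib, hsum, sub_self]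

/-- The equality case of Gibbs' inequality. -/
theorem sum_mul_log_sub_log_eq_zero_iff (hp : ∀ y, 0 < p y) (hq : ∀ y, 0 < q y)
    (hsum : ∑ y, p y = ∑ y, q y) :
    ∑ y, p y * (Real.log (q y) - Real.log (p y)) = 0 ↔ p = q := by
  refine ⟨fun h => ?_, fun h => by simp [h]⟩
  by_contra hne
  obtain ⟨y, hy⟩ := Function.ne_iff.mp hne
  have hlt : ∑ y, p y * (Real.log (q y) - Real.log (p y)) < ∑ y, (q y - p y) :=
    Finset.sum_lt_sum (fun y _ => mul_log_sub_log_le_sub (hp y) (hq y))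
      ⟨y, Finset.mem_univ y, mul_log_sub_log_lt_sub (hp y) (hq y) hy⟩
  rw [h, Finset.sum_sub_distrib, hsum, sub_self] at hlt
  exact lt_irrefl 0 hlt

/-- For the reward `β * (log q - log ref)`, the KL-regularized objective at `p` is `-β` times the
Kullback–Leibler divergence of `p` from `q`. -/
theorem klRegularized_objective_eq (β : ℝ) {ref : Y → ℝ} (hp : ∀ y, 0 < p y)
    (href : ∀ y, 0 < ref y) :
    (∑ y, p y * (β * (Real.log (q y) - Real.log (ref y))))
        - β * ∑ y, p y * Real.log (p y / ref y)
      = β * ∑ y, p y * (Real.log (q y) - Real.log (p y)) := by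
  rw [Finset.mul_sum, Finset.mul_sum, ← Finset.sum_sub_distrib]
  refine Finset.sum_congr rfl fun y _ => ?_
  rw [Real.log_div (hp y).ne' (href y).ne']
  ring

end Gibbs

/-- existence part of the reward–policy bijection: with the reward
`r(y) = β·(log π_θ(y) − log π_ref(y))`, the policy `π_θ` is the unique maximizer
of the KL-regularized alignment objective
`F(π) = Σ_y π(y)·r(y) − β·Σ_y π(y)·log(π(y)/π_ref(y))`. -/
theorem stmt_2 {Y : Type*} [Fintype Y] [Nonempty Y]
    (β : ℝ) (hβ : 0 < β) (πθ πref : Y → ℝ)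
    (hθpos : ∀ y, 0 < πθ y) (hθsum : ∑ y, πθ y = 1)
    (hrefpos : ∀ y, 0 < πref y) (hrefsum : ∑ y, πref y = 1) :
    ∀ π : Y → ℝ, (∀ y, 0 < π y) → (∑ y, π y = 1) →
      ((∑ y, π y * (β * (Real.log (πθ y) - Real.log (πref y))))
          - β * ∑ y, π y * Real.log (π y / πref y)
        ≤ (∑ y, πθ y * (β * (Real.log (πθ y) - Real.log (πref y))))
          - β * ∑ y, πθ y * Real.log (πθ y / πref y))
      ∧ ((∑ y, π y * (β * (Real.log (πθ y) - Real.log (πref y))))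
            - β * ∑ y, π y * Real.log (π y / πref y)
          = (∑ y, πθ y * (β * (Real.log (πθ y) - Real.log (πref y))))
            - β * ∑ y, πθ y * Real.log (πθ y / πref y)
        ↔ π = πθ) := by
  intro π hpos hsum
  have hsums : ∑ y, π y = ∑ y, πθ y := hsum.trans hθsum.symm
  rw [klRegularized_objective_eq β hpos hrefpos, klRegularized_objective_eq β hθpos hrefpos]
  simp only [sub_self, mul_zero, Finset.sum_const_zero]
  refine ⟨mul_nonpos_of_nonneg_of_nonpos hβ.le (sum_mul_log_sub_log_nonpos hpos hθpos hsums), ?_⟩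
  rw [mul_eq_zero_iff_left hβ.ne']
  exact sum_mul_log_sub_log_eq_zero_iff hpos hθpos hsums
end

section
/- (Uniqueness part of the bijection between reward functions and policies.) Let Y be a nonempty finite type, β > 0, and let π_θ and π_ref be positive probability distributions on Y. For a reward r : Y → ℝ write π*_r(y) = π_ref(y)·exp(r(y)/β) / Σ_{y'} π_ref(y')·exp(r(y')/β) for its Gibbs distribution. If r₁, r₂ : Y → ℝ satisfy π*_{r₁} = π_θ and π*_{r₂} = π_θ, then there exists a constant c ∈ ℝ with r₁(y) = r₂(y) + c for all y. Conversely, if r₂ = r₁ + c for a constant c, then π*_{r₁} = π*_{r₂}. -/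
/-- The Gibbs distribution `π*_r(y) = π_ref(y)·exp(r(y)/β) / Σ_{y'} π_ref(y')·exp(r(y')/β)`. -/
noncomputable def gibbs {Y : Type*} [Fintype Y] (β : ℝ) (πref r : Y → ℝ) : Y → ℝ :=
  fun y => πref y * Real.exp (r y / β) / ∑ y', πref y' * Real.exp (r y' / β)

/-- A reward is recovered from its Gibbs distribution up to the log-partition function. -/
theorem reward_eq_log_gibbs {Y : Type*} [Fintype Y] [Nonempty Y] {β : ℝ} (hβ : β ≠ 0)
    {πref : Y → ℝ} (hrefpos : ∀ y, 0 < πref y) (r : Y → ℝ) (y : Y) :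
    r y = β * (Real.log (gibbs β πref r y) - Real.log (πref y)) +
      β * Real.log (∑ y', πref y' * Real.exp (r y' / β)) := by
  have hZ : 0 < ∑ y', πref y' * Real.exp (r y' / β) :=
    Finset.sum_pos (fun y _ => mul_pos (hrefpos y) (Real.exp_pos _)) Finset.univ_nonempty
  unfold gibbs
  rw [Real.log_div (mul_pos (hrefpos y) (Real.exp_pos _)).ne' hZ.ne',
    Real.log_mul (hrefpos y).ne' (Real.exp_ne_zero _), Real.log_exp]
  field_simp
  ring

/-- The Gibbs distribution is invariant under shifting the reward by a constant. -/
theorem gibbs_add_const {Y : Type*} [Fintype Y] (β : ℝ) (πref r : Y → ℝ) (c : ℝ) :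
    gibbs β πref (fun y => r y + c) = gibbs β πref r := by
  funext y
  simp only [gibbs, add_div, Real.exp_add, ← mul_assoc, ← Finset.sum_mul]
  exact mul_div_mul_right _ _ (Real.exp_ne_zero _)

/-- uniqueness part of the reward–policy bijection: two rewards whose
Gibbs distributions both equal `π_θ` differ by an additive constant; conversely,
shifting a reward by a constant leaves its Gibbs distribution unchanged. -/
theorem stmt_3 {Y : Type*} [Fintype Y] [Nonempty Y]
    (β : ℝ) (hβ : 0 < β) (πθ πref : Y → ℝ)
    (hθpos : ∀ y, 0 < πθ y) (hθsum : ∑ y, πθ y = 1)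
    (hrefpos : ∀ y, 0 < πref y) (hrefsum : ∑ y, πref y = 1) :
    (∀ r₁ r₂ : Y → ℝ, gibbs β πref r₁ = πθ → gibbs β πref r₂ = πθ →
        ∃ c : ℝ, ∀ y, r₁ y = r₂ y + c)
    ∧ (∀ (r₁ : Y → ℝ) (c : ℝ),
        gibbs β πref r₁ = gibbs β πref (fun y => r₁ y + c)) := by
  refine ⟨fun r₁ r₂ h₁ h₂ => ?_, fun r₁ c => (gibbs_add_const β πref r₁ c).symm⟩
  refine ⟨β * Real.log (∑ y', πref y' * Real.exp (r₁ y' / β)) -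
    β * Real.log (∑ y', πref y' * Real.exp (r₂ y' / β)), fun y => ?_⟩
  have e₁ := reward_eq_log_gibbs hβ.ne' hrefpos r₁ y
  have e₂ := reward_eq_log_gibbs hβ.ne' hrefpos r₂ y
  rw [h₁] at e₁
  rw [h₂] at e₂
  linarith
end

section
/- Let Y be a nonempty finite type, β > 0, and let π_θ and π_ref be positive probability distributions on Y. Then there is exactly one reward function r : Y → ℝ satisfying both Σ_y π_ref(y)·exp(r(y)/β) = 1 and π_θ(y) = π_ref(y)·exp(r(y)/β) for all y ∈ Y, namely r(y) = β·(log π_θ(y) − log π_ref(y)). -/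
/-- there is exactly one reward `r` with partition function 1 whose
Gibbs reweighting of `π_ref` equals `π_θ`, namely
`r(y) = β·(log π_θ(y) − log π_ref(y))`. -/
theorem stmt_4 {Y : Type*} [Fintype Y] [Nonempty Y]
    (β : ℝ) (hβ : 0 < β) (πθ πref : Y → ℝ)
    (hθpos : ∀ y, 0 < πθ y) (hθsum : ∑ y, πθ y = 1)
    (hrefpos : ∀ y, 0 < πref y) (hrefsum : ∑ y, πref y = 1) :
    ∀ r : Y → ℝ,
      ((∑ y, πref y * Real.exp (r y / β)) = 1
        ∧ ∀ y, πθ y = πref y * Real.exp (r y / β))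
      ↔ r = fun y => β * (Real.log (πθ y) - Real.log (πref y)) := by
  intro r
  constructor
  · rintro ⟨-, h⟩
    funext y
    rw [h y, Real.log_mul (hrefpos y).ne' (Real.exp_pos _).ne', Real.log_exp]
    field_simp
    ring
  · rintro rfl
    have h : ∀ y, πθ y =
        πref y * Real.exp (β * (Real.log (πθ y) - Real.log (πref y)) / β) := by
      intro y
      rw [mul_div_cancel_left₀ _ hβ.ne', Real.exp_sub, Real.exp_log (hθpos y),
        Real.exp_log (hrefpos y), mul_div_cancel₀ _ (hrefpos y).ne']
    exact ⟨(Finset.sum_congr rfl fun y _ => (h y).symm).trans hθsum, h⟩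
end

section
/- (Infimum of the finite-sample DPO loss is zero.) Let Y be a nonempty finite type, β > 0, π_ref a positive probability distribution on Y, and D a nonempty finite multiset of pairs (y_w, y_l) ∈ Y × Y with y_w ≠ y_l. Assume the preference data is realizable, i.e., there exists s : Y → ℝ with s(y_w) > s(y_l) for every pair (y_w, y_l) ∈ D. Then for every ε > 0 there exists a positive probability distribution π on Y with L_DPO(π) < ε; hence the infimum of L_DPO over positive probability distributions on Y equals 0. -/
/-- The logistic sigmoid `σ(t) = 1/(1 + exp(−t))`. -/
noncomputable def logisticSigmoid (t : ℝ) : ℝ := 1 / (1 + Real.exp (-t))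

/-- The finite-sample DPO loss of a policy `π` against reference `π_ref` on the
preference multiset `D`:
`L_DPO(π) = (1/|D|)·Σ_{(y_w,y_l)∈D} −log σ(β·log(π(y_w)/π_ref(y_w)) − β·log(π(y_l)/π_ref(y_l)))`. -/
noncomputable def dpoLoss {Y : Type*} (β : ℝ) (πref π : Y → ℝ)
    (D : Multiset (Y × Y)) : ℝ :=
  (D.card : ℝ)⁻¹ *
    (D.map (fun p =>
      - Real.log (logisticSigmoid
          (β * Real.log (π p.1 / πref p.1) - β * Real.log (π p.2 / πref p.2))))).sum

open Filter Topology in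
/-- The logistic loss vanishes as the margin tends to infinity. -/
theorem tendsto_neg_log_logisticSigmoid_atTop :
    Tendsto (fun t : ℝ => -Real.log (logisticSigmoid t)) atTop (𝓝 0) := by
  have hexp : Tendsto (fun t : ℝ => Real.exp (-t)) atTop (𝓝 0) :=
    Real.tendsto_exp_neg_atTop_nhds_zero
  have hsig : Tendsto (fun t => logisticSigmoid t) atTop (𝓝 1) := by
    have h := (tendsto_const_nhds (x := (1 : ℝ))).div (hexp.const_add 1) (by norm_num)
    simpa only [logisticSigmoid, Pi.div_def, add_zero, div_one] using h
  simpa using (hsig.log one_ne_zero).neg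

theorem neg_log_logisticSigmoid_nonneg (t : ℝ) : 0 ≤ -Real.log (logisticSigmoid t) := by
  have h : 0 < Real.exp (-t) := Real.exp_pos _
  rw [logisticSigmoid, one_div, Real.log_inv, neg_neg]
  exact Real.log_nonneg (by linarith)

theorem dpoLoss_nonneg {Y : Type*} (β : ℝ) (πref π : Y → ℝ) (D : Multiset (Y × Y)) :
    0 ≤ dpoLoss β πref π D := by
  refine mul_nonneg (by positivity) (Multiset.sum_nonneg fun x hx => ?_)
  obtain ⟨p, -, rfl⟩ := Multiset.mem_map.1 hx
  exact neg_log_logisticSigmoid_nonneg _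

/-- The exponential tilt of `πref` by the score `s` at inverse temperature `t`. -/
noncomputable def gibbsPolicy {Y : Type*} [Fintype Y] (πref s : Y → ℝ) (t : ℝ) (y : Y) : ℝ :=
  πref y * Real.exp (t * s y) / ∑ z, πref z * Real.exp (t * s z)

section gibbsPolicy

variable {Y : Type*} [Fintype Y] [Nonempty Y] {πref : Y → ℝ}

theorem gibbsPolicy_partition_pos (hπ : ∀ y, 0 < πref y) (s : Y → ℝ) (t : ℝ) :
    0 < ∑ z, πref z * Real.exp (t * s z) :=
  Finset.sum_pos (fun z _ => mul_pos (hπ z) (Real.exp_pos _)) Finset.univ_nonempty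

theorem gibbsPolicy_pos (hπ : ∀ y, 0 < πref y) (s : Y → ℝ) (t : ℝ) (y : Y) :
    0 < gibbsPolicy πref s t y :=
  div_pos (mul_pos (hπ y) (Real.exp_pos _)) (gibbsPolicy_partition_pos hπ s t)

theorem sum_gibbsPolicy (hπ : ∀ y, 0 < πref y) (s : Y → ℝ) (t : ℝ) :
    ∑ y, gibbsPolicy πref s t y = 1 := by
  simp only [gibbsPolicy]
  rw [← Finset.sum_div, div_self (gibbsPolicy_partition_pos hπ s t).ne']

theorem log_gibbsPolicy_div (hπ : ∀ y, 0 < πref y) (s : Y → ℝ) (t : ℝ) (y : Y) :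
    Real.log (gibbsPolicy πref s t y / πref y) =
      t * s y - Real.log (∑ z, πref z * Real.exp (t * s z)) := by
  have h : gibbsPolicy πref s t y / πref y =
      Real.exp (t * s y) / ∑ z, πref z * Real.exp (t * s z) := by
    rw [gibbsPolicy, div_right_comm, mul_div_cancel_left₀ _ (hπ y).ne']
  rw [h, Real.log_div (Real.exp_ne_zero _) (gibbsPolicy_partition_pos hπ s t).ne', Real.log_exp]

open Filter Topology in
/-- If `s` ranks every pair of `D` correctly, the DPO loss vanishes along the exponential tilts
of `πref` by `s`. -/
theorem tendsto_dpoLoss_gibbsPolicy {β : ℝ} (hβ : 0 < β) (hπ : ∀ y, 0 < πref y)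
    {D : Multiset (Y × Y)} {s : Y → ℝ} (hs : ∀ p ∈ D, s p.2 < s p.1) :
    Tendsto (fun t => dpoLoss β πref (gibbsPolicy πref s t) D) atTop (𝓝 0) := by
  have hpair : ∀ p ∈ D, Tendsto (fun t => -Real.log (logisticSigmoid
      (β * Real.log (gibbsPolicy πref s t p.1 / πref p.1) -
        β * Real.log (gibbsPolicy πref s t p.2 / πref p.2)))) atTop (𝓝 0) := by
    intro p hp
    have hmargin : Tendsto (fun t : ℝ => t * (β * (s p.1 - s p.2))) atTop atTop :=
      tendsto_id.atTop_mul_const (mul_pos hβ (sub_pos.2 (hs p hp)))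
    refine (tendsto_neg_log_logisticSigmoid_atTop.comp hmargin).congr fun t => ?_
    simp only [Function.comp_apply, log_gibbsPolicy_div hπ]
    ring_nf
  have hsum := tendsto_multiset_sum D hpair
  simpa [dpoLoss] using hsum.const_mul (D.card : ℝ)⁻¹

end gibbsPolicy

/-- under realizability of the preference data, the DPO loss can be
made smaller than any `ε > 0` by some positive probability distribution; hence
the infimum of `L_DPO` over positive probability distributions is `0`. -/
theorem stmt_5 {Y : Type*} [Fintype Y] [Nonempty Y]
    (β : ℝ) (hβ : 0 < β) (πref : Y → ℝ)
    (hrefpos : ∀ y, 0 < πref y) (hrefsum : ∑ y, πref y = 1)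
    (D : Multiset (Y × Y)) (hD : D ≠ 0) (hDne : ∀ p ∈ D, p.1 ≠ p.2)
    (hreal : ∃ s : Y → ℝ, ∀ p ∈ D, s p.2 < s p.1) :
    (∀ ε > (0 : ℝ), ∃ π : Y → ℝ,
        (∀ y, 0 < π y) ∧ (∑ y, π y = 1) ∧ dpoLoss β πref π D < ε)
    ∧ sInf {x : ℝ | ∃ π : Y → ℝ,
        (∀ y, 0 < π y) ∧ (∑ y, π y = 1) ∧ dpoLoss β πref π D = x} = 0 := by
  obtain ⟨s, hs⟩ := hreal
  have hsmall : ∀ ε > (0 : ℝ), ∃ π : Y → ℝ,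
      (∀ y, 0 < π y) ∧ (∑ y, π y = 1) ∧ dpoLoss β πref π D < ε := fun ε hε => by
    obtain ⟨t, ht⟩ := ((tendsto_dpoLoss_gibbsPolicy hβ hrefpos hs).eventually_lt_const hε).exists
    exact ⟨gibbsPolicy πref s t, gibbsPolicy_pos hrefpos s t, sum_gibbsPolicy hrefpos s t, ht⟩
  refine ⟨hsmall, csInf_eq_of_forall_ge_of_forall_gt_exists_lt ?_ ?_ ?_⟩
  · exact ⟨_, πref, hrefpos, hrefsum, rfl⟩
  · rintro x ⟨π, -, -, rfl⟩
    exact dpoLoss_nonneg β πref π D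
  · intro ε hε
    obtain ⟨π, hpos, hsum, hlt⟩ := hsmall ε hε
    exact ⟨_, ⟨π, hpos, hsum, rfl⟩, hlt⟩
end

section
/- (The finite-sample DPO loss has no minimizer among positive policies.) Let Y be a nonempty finite type, β > 0, π_ref a positive probability distribution on Y, and D a nonempty finite multiset of pairs (y_w, y_l) ∈ Y × Y with y_w ≠ y_l. Then L_DPO(π) > 0 for every positive probability distribution π on Y. Moreover, if there exists s : Y → ℝ with s(y_w) > s(y_l) for every pair in D, then for every positive probability distribution π there exists a positive probability distribution π' with L_DPO(π') < L_DPO(π); consequently no positive probability distribution minimizes L_DPO. In particular, for any reward r : Y → ℝ, the Gibbs distribution π*(y) = π_ref(y)·exp(r(y)/β)/Σ_{y'} π_ref(y')·exp(r(y')/β) — the unique optimum of the KL-regularized alignment objective — is not a minimizer of L_DPO. -/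
theorem logisticSigmoid_pos (t : ℝ) : 0 < logisticSigmoid t := by
  unfold logisticSigmoid
  positivity

theorem logisticSigmoid_lt_one (t : ℝ) : logisticSigmoid t < 1 := by
  unfold logisticSigmoid
  rw [div_lt_one (by positivity)]
  linarith [Real.exp_pos (-t)]

theorem logisticSigmoid_strictMono : StrictMono logisticSigmoid := by
  intro a b hab
  unfold logisticSigmoid
  gcongr

theorem gibbs_pos {Y : Type*} [Fintype Y] [Nonempty Y] (β : ℝ) {πref : Y → ℝ}
    (hpos : ∀ y, 0 < πref y) (r : Y → ℝ) (y : Y) : 0 < gibbs β πref r y :=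
  div_pos (mul_pos (hpos y) (Real.exp_pos _))
    (Finset.sum_pos (fun z _ => mul_pos (hpos z) (Real.exp_pos _)) Finset.univ_nonempty)

theorem sum_gibbs {Y : Type*} [Fintype Y] [Nonempty Y] (β : ℝ) {πref : Y → ℝ}
    (hpos : ∀ y, 0 < πref y) (r : Y → ℝ) : ∑ y, gibbs β πref r y = 1 := by
  unfold gibbs
  rw [← Finset.sum_div]
  exact div_self
    (Finset.sum_pos (fun z _ => mul_pos (hpos z) (Real.exp_pos _)) Finset.univ_nonempty).ne'

theorem log_gibbs_div {Y : Type*} [Fintype Y] [Nonempty Y] (β : ℝ) {π : Y → ℝ}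
    (hpos : ∀ y, 0 < π y) (r : Y → ℝ) (y : Y) {c : ℝ} (hc : 0 < c) :
    Real.log (gibbs β π r y / c) =
      Real.log (π y / c) + r y / β - Real.log (∑ z, π z * Real.exp (r z / β)) := by
  have hZ : 0 < ∑ z, π z * Real.exp (r z / β) :=
    Finset.sum_pos (fun z _ => mul_pos (hpos z) (Real.exp_pos _)) Finset.univ_nonempty
  unfold gibbs
  rw [Real.log_div (div_pos (mul_pos (hpos y) (Real.exp_pos _)) hZ).ne' hc.ne',
    Real.log_div (mul_pos (hpos y) (Real.exp_pos _)).ne' hZ.ne',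
    Real.log_mul (hpos y).ne' (Real.exp_pos _).ne', Real.log_exp,
    Real.log_div (hpos y).ne' hc.ne']
  ring

theorem dpoLoss_pos {Y : Type*} (β : ℝ) (πref π : Y → ℝ) {D : Multiset (Y × Y)}
    (hD : D ≠ 0) : 0 < dpoLoss β πref π D := by
  have hcard : (0 : ℝ) < D.card := by exact_mod_cast Multiset.card_pos.mpr hD
  refine mul_pos (inv_pos.mpr hcard) ?_
  have h := Multiset.sum_lt_sum_of_nonempty (s := D) (f := fun _ => (0 : ℝ)) hD fun p _ =>
    neg_pos.mpr (Real.log_neg (logisticSigmoid_pos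
      (β * Real.log (π p.1 / πref p.1) - β * Real.log (π p.2 / πref p.2)))
      (logisticSigmoid_lt_one _))
  simpa only [Multiset.map_const', Multiset.sum_replicate, smul_zero] using h

/-- Tilting a positive policy by a score that ranks every pair correctly lowers the loss. -/
theorem dpoLoss_gibbs_lt {Y : Type*} [Fintype Y] [Nonempty Y] {β : ℝ} (hβ : 0 < β)
    {πref π : Y → ℝ} (hrefpos : ∀ y, 0 < πref y) (hpos : ∀ y, 0 < π y)
    {D : Multiset (Y × Y)} (hD : D ≠ 0) {s : Y → ℝ} (hs : ∀ p ∈ D, s p.2 < s p.1) :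
    dpoLoss β πref (gibbs β π s) D < dpoLoss β πref π D := by
  have hcard : (0 : ℝ) < D.card := by exact_mod_cast Multiset.card_pos.mpr hD
  refine mul_lt_mul_of_pos_left ?_ (inv_pos.mpr hcard)
  refine Multiset.sum_lt_sum_of_nonempty hD fun p hp => ?_
  refine neg_lt_neg (Real.log_lt_log (logisticSigmoid_pos _) (logisticSigmoid_strictMono ?_))
  rw [log_gibbs_div β hpos s p.1 (hrefpos _), log_gibbs_div β hpos s p.2 (hrefpos _)]
  have h : β * (s p.2 / β) < β * (s p.1 / β) := by
    rw [mul_div_cancel₀ _ hβ.ne', mul_div_cancel₀ _ hβ.ne']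
    exact hs p hp
  linarith

/-- the finite-sample DPO loss is strictly positive on every positive
probability distribution; under realizability every positive policy admits a
strictly better positive policy, so no positive probability distribution
minimizes `L_DPO`; in particular no Gibbs distribution (the optimum of the
KL-regularized alignment objective for any reward) is a minimizer. -/
theorem stmt_6 {Y : Type*} [Fintype Y] [Nonempty Y]
    (β : ℝ) (hβ : 0 < β) (πref : Y → ℝ)
    (hrefpos : ∀ y, 0 < πref y) (hrefsum : ∑ y, πref y = 1)
    (D : Multiset (Y × Y)) (hD : D ≠ 0) (hDne : ∀ p ∈ D, p.1 ≠ p.2) :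
    (∀ π : Y → ℝ, (∀ y, 0 < π y) → (∑ y, π y = 1) → 0 < dpoLoss β πref π D)
    ∧ ((∃ s : Y → ℝ, ∀ p ∈ D, s p.2 < s p.1) →
        (∀ π : Y → ℝ, (∀ y, 0 < π y) → (∑ y, π y = 1) →
          ∃ π' : Y → ℝ, (∀ y, 0 < π' y) ∧ (∑ y, π' y = 1) ∧
            dpoLoss β πref π' D < dpoLoss β πref π D)
        ∧ (¬ ∃ π : Y → ℝ, (∀ y, 0 < π y) ∧ (∑ y, π y = 1) ∧
            ∀ π' : Y → ℝ, (∀ y, 0 < π' y) → (∑ y, π' y = 1) →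
              dpoLoss β πref π D ≤ dpoLoss β πref π' D)
        ∧ (∀ r : Y → ℝ,
            ¬ ∀ π' : Y → ℝ, (∀ y, 0 < π' y) → (∑ y, π' y = 1) →
              dpoLoss β πref (gibbs β πref r) D ≤ dpoLoss β πref π' D)) := by
  refine ⟨fun π _ _ => dpoLoss_pos β πref π hD, fun ⟨s, hs⟩ => ?_⟩
  have improve : ∀ π : Y → ℝ, (∀ y, 0 < π y) →
      ∃ π' : Y → ℝ, (∀ y, 0 < π' y) ∧ (∑ y, π' y = 1) ∧
        dpoLoss β πref π' D < dpoLoss β πref π D := fun π hpos =>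
    ⟨gibbs β π s, gibbs_pos β hpos s, sum_gibbs β hpos s,
      dpoLoss_gibbs_lt hβ hrefpos hpos hD hs⟩
  refine ⟨fun π hpos _ => improve π hpos, ?_, fun r hmin => ?_⟩
  · rintro ⟨π, hpos, -, hmin⟩
    obtain ⟨π', hpos', hsum', hlt⟩ := improve π hpos
    exact (hmin π' hpos' hsum').not_gt hlt
  · obtain ⟨π', hpos', hsum', hlt⟩ := improve _ (gibbs_pos β hrefpos r)
    exact (hmin π' hpos' hsum').not_gt hlt
end

section
/- (Uniqueness of the general text distribution π_G.) Let Y be a nonempty finite type and let π₁ and π₂ be positive probability distributions on Y. If σ(log π₁(y₁) − log π₁(y₂)) = σ(log π₂(y₁) − log π₂(y₂)) for all y₁, y₂ ∈ Y, then π₁ = π₂. Hence a Bradley–Terry preference distribution determines the underlying positive probability distribution uniquely. -/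
theorem logisticSigmoid_injective : Function.Injective logisticSigmoid := fun a b h ↦
  Real.sigmoid_injective (by simpa only [logisticSigmoid, one_div, Real.sigmoid_def] using h)

/-- Positive weights with the same Bradley–Terry preferences are proportional. -/
theorem mul_eq_mul_of_logisticSigmoid_eq {a b c d : ℝ}
    (ha : 0 < a) (hb : 0 < b) (hc : 0 < c) (hd : 0 < d)
    (h : logisticSigmoid (Real.log a - Real.log b)
      = logisticSigmoid (Real.log c - Real.log d)) :
    a * d = c * b := by
  have hlog := logisticSigmoid_injective h
  rw [← Real.log_div ha.ne' hb.ne', ← Real.log_div hc.ne' hd.ne'] at hlog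
  exact (div_eq_div_iff hb.ne' hd.ne').1
    (Real.log_injOn_pos (div_pos ha hb) (div_pos hc hd) hlog)

/-- uniqueness of the general text distribution `π_G`: a
Bradley–Terry preference distribution determines the underlying positive
probability distribution uniquely. -/
theorem stmt_7 {Y : Type*} [Fintype Y] [Nonempty Y]
    (π₁ π₂ : Y → ℝ)
    (h₁pos : ∀ y, 0 < π₁ y) (h₁sum : ∑ y, π₁ y = 1)
    (h₂pos : ∀ y, 0 < π₂ y) (h₂sum : ∑ y, π₂ y = 1)
    (hpref : ∀ y₁ y₂ : Y,
      logisticSigmoid (Real.log (π₁ y₁) - Real.log (π₁ y₂))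
        = logisticSigmoid (Real.log (π₂ y₁) - Real.log (π₂ y₂))) :
    π₁ = π₂ := by
  funext y
  calc π₁ y = ∑ z, π₁ y * π₂ z := by rw [← Finset.mul_sum, h₂sum, mul_one]
    _ = ∑ z, π₂ y * π₁ z := Finset.sum_congr rfl fun z _ ↦
      mul_eq_mul_of_logisticSigmoid_eq (h₁pos y) (h₁pos z) (h₂pos y) (h₂pos z) (hpref y z)
    _ = π₂ y := by rw [← Finset.mul_sum, h₁sum, mul_one]
end

section
/- (Characterization of well-defined Bradley–Terry preference distributions.) Let Y be a nonempty finite type and let P : Y × Y → ℝ take values in the open interval (0,1). Then there exists a positive probability distribution π on Y with P(y₁, y₂) = σ(log π(y₁) − log π(y₂)) for all y₁, y₂ if and only if P satisfies: (i) P(y₁, y₂) + P(y₂, y₁) = 1 for all y₁, y₂ ∈ Y, and (ii) the odds are multiplicatively transitive, i.e., (P(y₁, y₂)/P(y₂, y₁))·(P(y₂, y₃)/P(y₃, y₂)) = P(y₁, y₃)/P(y₃, y₁) for all y₁, y₂, y₃ ∈ Y. -/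
/-- The Bradley–Terry preference probability in terms of the two weights. -/
theorem logisticSigmoid_log_sub_log {a b : ℝ} (ha : 0 < a) (hb : 0 < b) :
    logisticSigmoid (Real.log a - Real.log b) = a / (a + b) := by
  rw [logisticSigmoid, neg_sub, Real.exp_sub, Real.exp_log ha, Real.exp_log hb]
  field_simp

/-- characterization of well-defined Bradley–Terry preference
distributions: a function `P : Y × Y → (0,1)` arises from a positive
probability distribution via the Bradley–Terry model iff it is complementary
(`P(y₁,y₂) + P(y₂,y₁) = 1`) and its odds are multiplicatively transitive. -/
theorem stmt_9 {Y : Type*} [Fintype Y] [Nonempty Y]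
    (P : Y × Y → ℝ) (hrange : ∀ p : Y × Y, P p ∈ Set.Ioo (0 : ℝ) 1) :
    (∃ π : Y → ℝ, (∀ y, 0 < π y) ∧ (∑ y, π y = 1) ∧
        ∀ y₁ y₂ : Y, P (y₁, y₂) = logisticSigmoid (Real.log (π y₁) - Real.log (π y₂)))
    ↔ ((∀ y₁ y₂ : Y, P (y₁, y₂) + P (y₂, y₁) = 1)
      ∧ (∀ y₁ y₂ y₃ : Y,
          (P (y₁, y₂) / P (y₂, y₁)) * (P (y₂, y₃) / P (y₃, y₂))
            = P (y₁, y₃) / P (y₃, y₁))) := by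
  constructor
  · rintro ⟨π, hπ, -, hP⟩
    have hP' (y₁ y₂ : Y) : P (y₁, y₂) = π y₁ / (π y₁ + π y₂) := by
      rw [hP, logisticSigmoid_log_sub_log (hπ y₁) (hπ y₂)]
    have hodds (y₁ y₂ : Y) : P (y₁, y₂) / P (y₂, y₁) = π y₁ / π y₂ := by
      have h₁ := hπ y₁
      have h₂ := hπ y₂
      rw [hP', hP', add_comm (π y₂), div_div_div_cancel_right₀ (by positivity)]
    refine ⟨fun y₁ y₂ ↦ ?_, fun y₁ y₂ y₃ ↦ ?_⟩
    · have h₁ := hπ y₁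
      have h₂ := hπ y₂
      rw [hP', hP', add_comm (π y₂), ← add_div, div_self (by positivity)]
    · rw [hodds, hodds, hodds, div_mul_div_cancel₀ (hπ y₂).ne']
  · rintro ⟨hsum, htrans⟩
    obtain ⟨y₀⟩ := ‹Nonempty Y›
    have hpos (p : Y × Y) : 0 < P p := (hrange p).1
    set w : Y → ℝ := fun y ↦ P (y, y₀) / P (y₀, y)
    have hw (y : Y) : 0 < w y := div_pos (hpos _) (hpos _)
    have hS : 0 < ∑ y, w y := Finset.sum_pos (fun y _ ↦ hw y) ⟨y₀, Finset.mem_univ y₀⟩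
    refine ⟨fun y ↦ w y / ∑ z, w z, fun y ↦ div_pos (hw y) hS, ?_, fun y₁ y₂ ↦ ?_⟩
    · rw [← Finset.sum_div, div_self hS.ne']
    · have h₁ := hw y₁
      have h₂ := hw y₂
      have hodds : P (y₁, y₂) / P (y₂, y₁) * w y₂ = w y₁ := htrans y₁ y₂ y₀
      rw [div_mul_eq_mul_div, div_eq_iff (hpos _).ne'] at hodds
      rw [logisticSigmoid_log_sub_log (div_pos h₁ hS) (div_pos h₂ hS), ← add_div,
        div_div_div_cancel_right₀ hS.ne', eq_div_iff (by positivity)]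
      linear_combination hodds + w y₁ * hsum y₁ y₂
end
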